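/- Let n ≥ 2 and let G ⊆ ℝⁿ be a bounded subregion. Define the isoperimetric profile ℓ : [0, Lⁿ(G)) → ℝ by ℓ(A) := inf{ Per(E) : E ⊆ cl(G) Lebesgue measurable with Lⁿ(E) = A }. Then ℓ maps the interval [0, Lⁿ(G)) bijectively onto the interval [0, Per(G)); in particular ℓ(A) → Per(G) as A → Lⁿ(G). -/

import Mathlib

open MeasureTheory
open scoped ENNReal

/-- The divergence of a vector field on `ℝⁿ`. -/
noncomputable def vecDiv {n : ℕ} (φ : EuclideanSpace ℝ (Fin n) → EuclideanSpace ℝ (Fin n))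
    (x : EuclideanSpace ℝ (Fin n)) : ℝ :=
  ∑ i : Fin n, fderiv ℝ φ x (EuclideanSpace.single i 1) i

/-- The perimeter of a set `E` relative to an open set `F`:
`Per(E;F) = sup { ∫_E div φ dx : φ ∈ C¹_0(F, ℝⁿ), |φ| ≤ 1 }`. -/
noncomputable def perIn {n : ℕ} (E F : Set (EuclideanSpace ℝ (Fin n))) : ℝ≥0∞ :=
  ⨆ φ : {φ : EuclideanSpace ℝ (Fin n) → EuclideanSpace ℝ (Fin n) //
      ContDiff ℝ 1 φ ∧ HasCompactSupport φ ∧ tsupport φ ⊆ F ∧ ∀ x, ‖φ x‖ ≤ 1},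
    ENNReal.ofReal (∫ x in E, vecDiv φ.1 x)

/-- The perimeter of `E` (relative to all of `ℝⁿ`). -/
noncomputable def per {n : ℕ} (E : Set (EuclideanSpace ℝ (Fin n))) : ℝ≥0∞ :=
  perIn E Set.univ

/-- The isoperimetric profile of `G`:
`ℓ(A) = inf { Per(E) : E ⊆ cl(G) measurable, Lⁿ(E) = A }`. -/
noncomputable def isoProfile {n : ℕ} (G : Set (EuclideanSpace ℝ (Fin n))) (A : ℝ≥0∞) : ℝ≥0∞ :=
  sInf {P : ℝ≥0∞ | ∃ E : Set (EuclideanSpace ℝ (Fin n)),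
    MeasurableSet E ∧ E ⊆ closure G ∧ volume E = A ∧ per E = P}

open Filter Topology Metric

section Divergence

variable {n : ℕ}

lemma vecDiv_congr {φ ψ : EuclideanSpace ℝ (Fin n) → EuclideanSpace ℝ (Fin n)}
    {x : EuclideanSpace ℝ (Fin n)} (h : φ =ᶠ[𝓝 x] ψ) : vecDiv φ x = vecDiv ψ x := by
  simp only [vecDiv, h.fderiv_eq]

lemma vecDiv_add {φ ψ : EuclideanSpace ℝ (Fin n) → EuclideanSpace ℝ (Fin n)}
    {x : EuclideanSpace ℝ (Fin n)} (hφ : DifferentiableAt ℝ φ x) (hψ : DifferentiableAt ℝ ψ x) :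
    vecDiv (fun y => φ y + ψ y) x = vecDiv φ x + vecDiv ψ x := by
  simp only [vecDiv]
  rw [fderiv_fun_add hφ hψ, ← Finset.sum_add_distrib]
  simp

lemma vecDiv_smul {g : EuclideanSpace ℝ (Fin n) → ℝ}
    {φ : EuclideanSpace ℝ (Fin n) → EuclideanSpace ℝ (Fin n)}
    {x : EuclideanSpace ℝ (Fin n)} (hg : DifferentiableAt ℝ g x) (hφ : DifferentiableAt ℝ φ x) :
    vecDiv (fun y => g y • φ y) x = g x * vecDiv φ x + fderiv ℝ g x (φ x) := by
  have hsum : φ x = ∑ i, φ x i • EuclideanSpace.single i (1 : ℝ) := by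
    ext j
    simp [Finset.sum_apply, Pi.single_apply]
  have hD : fderiv ℝ g x (φ x) = ∑ i, fderiv ℝ g x (EuclideanSpace.single i 1) * φ x i := by
    conv_lhs => rw [hsum]
    rw [map_sum]
    exact Finset.sum_congr rfl fun i _ => by rw [map_smul, smul_eq_mul, mul_comm]
  rw [hD]
  simp only [vecDiv]
  rw [fderiv_fun_smul hg hφ, Finset.mul_sum, ← Finset.sum_add_distrib]
  simp

lemma vecDiv_sub_const (p x : EuclideanSpace ℝ (Fin n)) : vecDiv (fun y => y - p) x = n := by
  simp [vecDiv, fderiv_sub_const]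

lemma continuous_vecDiv {φ : EuclideanSpace ℝ (Fin n) → EuclideanSpace ℝ (Fin n)}
    (hφ : ContDiff ℝ 1 φ) : Continuous (vecDiv φ) := by
  have h := hφ.continuous_fderiv one_ne_zero
  unfold vecDiv
  fun_prop

lemma hasCompactSupport_vecDiv {φ : EuclideanSpace ℝ (Fin n) → EuclideanSpace ℝ (Fin n)}
    (hφ : HasCompactSupport φ) : HasCompactSupport (vecDiv φ) := by
  refine (hφ.fderiv ℝ).mono fun x hx h => hx ?_
  simp [vecDiv, h]

lemma integrable_vecDiv {φ : EuclideanSpace ℝ (Fin n) → EuclideanSpace ℝ (Fin n)}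
    (hφ : ContDiff ℝ 1 φ) (hc : HasCompactSupport φ) : Integrable (vecDiv φ) :=
  (continuous_vecDiv hφ).integrable_of_hasCompactSupport (hasCompactSupport_vecDiv hc)

lemma integral_vecDiv_eq_zero {φ : EuclideanSpace ℝ (Fin n) → EuclideanSpace ℝ (Fin n)}
    (hφ : ContDiff ℝ 1 φ) (hc : HasCompactSupport φ) : ∫ x, vecDiv φ x = 0 := by
  have hcont := hφ.continuous_fderiv one_ne_zero
  have hint (v : EuclideanSpace ℝ (Fin n)) : Integrable fun x => fderiv ℝ φ x v :=
    (hcont.clm_apply continuous_const).integrable_of_hasCompactSupport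
      ((hc.fderiv ℝ).mono fun x hx h => hx (by simp [h]))
  have hzero (v : EuclideanSpace ℝ (Fin n)) : ∫ x, fderiv ℝ φ x v = 0 := by
    have := integral_smul_fderiv_eq_neg_fderiv_smul_of_integrable (𝕜 := ℝ) (μ := volume)
      (f := fun _ : EuclideanSpace ℝ (Fin n) => (1 : ℝ)) (g := φ) (v := v)
      (by simp) (by simpa using hint v)
      (by simpa using hφ.continuous.integrable_of_hasCompactSupport hc)
      (fun _ _ => differentiableAt_const _)
      (fun x _ => hφ.differentiable one_ne_zero x)
    simpa using this
  have hcoord (i : Fin n) :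
      ∫ x, fderiv ℝ φ x (EuclideanSpace.single i 1) i = 0 := by
    have := (EuclideanSpace.proj i : EuclideanSpace ℝ (Fin n) →L[ℝ] ℝ).integral_comp_comm
      (hint (EuclideanSpace.single i 1))
    rw [hzero] at this
    simpa using this
  unfold vecDiv
  rw [integral_finsetSum]
  · simp [hcoord]
  · intro i _
    exact (EuclideanSpace.proj i : EuclideanSpace ℝ (Fin n) →L[ℝ] ℝ).integrable_comp
      (hint (EuclideanSpace.single i 1))

lemma vecDiv_sub {φ ψ : EuclideanSpace ℝ (Fin n) → EuclideanSpace ℝ (Fin n)}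
    {x : EuclideanSpace ℝ (Fin n)} (hφ : DifferentiableAt ℝ φ x) (hψ : DifferentiableAt ℝ ψ x) :
    vecDiv (fun y => φ y - ψ y) x = vecDiv φ x - vecDiv ψ x := by
  simp only [vecDiv]
  rw [fderiv_fun_sub hφ hψ, ← Finset.sum_sub_distrib]
  simp

lemma continuousOn_vecDiv {φ : EuclideanSpace ℝ (Fin n) → EuclideanSpace ℝ (Fin n)}
    {U : Set (EuclideanSpace ℝ (Fin n))} (hU : IsOpen U) (hφ : ContDiffOn ℝ 1 φ U) :
    ContinuousOn (vecDiv φ) U := by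
  have h := hφ.continuousOn_fderiv_of_isOpen hU le_rfl
  unfold vecDiv
  fun_prop

section SmoothTransition

lemma tendsto_smoothTransition_div (a : ℝ) :
    Tendsto (fun h => Real.smoothTransition (a / h)) (𝓝[>] 0) (𝓝 (if 0 < a then 1 else 0)) := by
  split_ifs with ha
  · refine tendsto_const_nhds.congr' ?_
    filter_upwards [Ioo_mem_nhdsGT ha] with h hh
    rw [Real.smoothTransition.one_of_one_le ((one_le_div hh.1).2 hh.2.le)]
  · refine tendsto_const_nhds.congr' ?_
    filter_upwards [self_mem_nhdsWithin] with h hh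
    rw [Real.smoothTransition.zero_of_nonpos
      (div_nonpos_of_nonpos_of_nonneg (not_lt.1 ha) (le_of_lt hh))]

lemma tendsto_integral_smoothTransition_mul {X : Type*} [TopologicalSpace X] [MeasurableSpace X]
    [BorelSpace X] {μ : Measure X} {f w : X → ℝ}
    (hf : Continuous f) (hw : Integrable w μ) :
    Tendsto (fun h => ∫ x, Real.smoothTransition (f x / h) * w x ∂μ) (𝓝[>] 0)
      (𝓝 (∫ x in {x | 0 < f x}, w x ∂μ)) := by
  have hmeas : MeasurableSet {x | 0 < f x} := (isOpen_lt continuous_const hf).measurableSet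
  rw [← integral_indicator hmeas]
  refine tendsto_integral_filter_of_dominated_convergence (fun x => ‖w x‖) ?_ ?_ hw.norm ?_
  · filter_upwards with h
    exact (Real.smoothTransition.continuous.measurable.comp
      (hf.measurable.div_const h)).aestronglyMeasurable.mul hw.aestronglyMeasurable
  · filter_upwards with h
    filter_upwards with x
    rw [norm_mul, Real.norm_of_nonneg (Real.smoothTransition.nonneg _)]
    exact mul_le_of_le_one_left (norm_nonneg _) (Real.smoothTransition.le_one _)
  · filter_upwards with x
    convert (tendsto_smoothTransition_div (f x)).mul_const (w x) using 2
    by_cases hx : 0 < f x <;> simp [Set.indicator, hx]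

lemma fderiv_smoothTransition_div {F : Type*} [NormedAddCommGroup F] [NormedSpace ℝ F]
    {f : F → ℝ} {x : F} (hf : DifferentiableAt ℝ f x) (h : ℝ) (v : F) :
    fderiv ℝ (fun y => Real.smoothTransition (f y / h)) x v =
      deriv Real.smoothTransition (f x / h) * (fderiv ℝ f x v / h) := by
  have hS : DifferentiableAt ℝ Real.smoothTransition (f x / h) :=
    (Real.smoothTransition.contDiff (n := 1)).differentiable one_ne_zero _
  have h1 : HasFDerivAt (fun y => f y / h) (h⁻¹ • fderiv ℝ f x) x := by
    simpa only [div_eq_mul_inv] using hf.hasFDerivAt.mul_const h⁻¹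
  have h2 : HasFDerivAt (fun y => Real.smoothTransition (f y / h))
      (deriv Real.smoothTransition (f x / h) • h⁻¹ • fderiv ℝ f x) x := by
    have := hS.hasDerivAt.comp_hasFDerivAt x h1
    exact this
  rw [h2.fderiv]
  simp [div_eq_inv_mul]

lemma differentiableAt_smoothTransition_div {F : Type*} [NormedAddCommGroup F] [NormedSpace ℝ F]
    {f : F → ℝ} {x : F} (hf : DifferentiableAt ℝ f x) (h : ℝ) :
    DifferentiableAt ℝ (fun y => Real.smoothTransition (f y / h)) x :=
  ((Real.smoothTransition.contDiff (n := 1)).differentiable one_ne_zero (f x / h)).comp x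
    (f := fun y => f y / h) (by fun_prop)

lemma contDiff_smoothTransition_div {F : Type*} [NormedAddCommGroup F] [NormedSpace ℝ F]
    {f : F → ℝ} (hf : ContDiff ℝ 1 f) (h : ℝ) :
    ContDiff ℝ 1 fun y => Real.smoothTransition (f y / h) :=
  Real.smoothTransition.contDiff.comp (hf.div_const h)

end SmoothTransition

end Divergence

section Perimeter

variable {n : ℕ}

lemma ofReal_integral_vecDiv_le_per {φ : EuclideanSpace ℝ (Fin n) → EuclideanSpace ℝ (Fin n)}
    (hφ : ContDiff ℝ 1 φ) (hc : HasCompactSupport φ) (hb : ∀ x, ‖φ x‖ ≤ 1)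
    (E : Set (EuclideanSpace ℝ (Fin n))) :
    ENNReal.ofReal (∫ x in E, vecDiv φ x) ≤ per E :=
  le_iSup (fun φ : {φ : EuclideanSpace ℝ (Fin n) → EuclideanSpace ℝ (Fin n) //
      ContDiff ℝ 1 φ ∧ HasCompactSupport φ ∧ tsupport φ ⊆ Set.univ ∧ ∀ x, ‖φ x‖ ≤ 1} =>
    ENNReal.ofReal (∫ x in E, vecDiv φ.1 x)) ⟨φ, hφ, hc, Set.subset_univ _, hb⟩

lemma per_le {E : Set (EuclideanSpace ℝ (Fin n))} {P : ℝ≥0∞}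
    (h : ∀ φ : EuclideanSpace ℝ (Fin n) → EuclideanSpace ℝ (Fin n), ContDiff ℝ 1 φ →
      HasCompactSupport φ → (∀ x, ‖φ x‖ ≤ 1) → ENNReal.ofReal (∫ x in E, vecDiv φ x) ≤ P) :
    per E ≤ P :=
  iSup_le fun φ => h φ.1 φ.2.1 φ.2.2.1 φ.2.2.2.2

lemma exists_of_lt_per {E : Set (EuclideanSpace ℝ (Fin n))} {P : ℝ≥0∞} (h : P < per E) :
    ∃ φ : EuclideanSpace ℝ (Fin n) → EuclideanSpace ℝ (Fin n), ContDiff ℝ 1 φ ∧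
      HasCompactSupport φ ∧ (∀ x, ‖φ x‖ ≤ 1) ∧ P < ENNReal.ofReal (∫ x in E, vecDiv φ x) := by
  obtain ⟨φ, hφ⟩ := lt_iSup_iff.1 h
  exact ⟨φ.1, φ.2.1, φ.2.2.1, φ.2.2.2.2, hφ⟩

/-- In the definition of the perimeter, the test field need only be defined and bounded by one
near the closure of a bounded set. -/
lemma ofReal_integral_vecDiv_le_per_of_contDiffOn
    {φ : EuclideanSpace ℝ (Fin n) → EuclideanSpace ℝ (Fin n)}
    {E K U : Set (EuclideanSpace ℝ (Fin n))} (hE : MeasurableSet E) (hEK : E ⊆ K)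
    (hK : IsCompact K) (hU : IsOpen U) (hKU : K ⊆ U)
    (hφ : ContDiffOn ℝ 1 φ U) (hb : ∀ x ∈ U, ‖φ x‖ ≤ 1) :
    ENNReal.ofReal (∫ x in E, vecDiv φ x) ≤ per E := by
  obtain ⟨χ, hχsmooth, hχc, hχ01, hχ1⟩ :
      ∃ χ : EuclideanSpace ℝ (Fin n) → ℝ, ContDiff ℝ 1 χ ∧ (HasCompactSupport χ ∧ tsupport χ ⊆ U) ∧
        (∀ x, χ x ∈ Set.Icc (0 : ℝ) 1) ∧ ∀ x ∈ K, χ =ᶠ[𝓝 x] 1 := by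
    obtain ⟨L, hL, hKL, hLU⟩ := exists_compact_between hK hU hKU
    obtain ⟨χ, h1, h0, h01⟩ := exists_contMDiffMap_one_nhds_of_subset_interior
      (modelWithCornersSelf ℝ (EuclideanSpace ℝ (Fin n))) (n := 1) hK.isClosed hKL
    have hts : tsupport χ ⊆ L :=
      closure_minimal (fun x hx => by_contra fun hxL => hx (h0 x hxL)) hL.isClosed
    refine ⟨χ, χ.contMDiff.contDiff, ⟨hL.of_isClosed_subset (isClosed_tsupport _) hts,
      hts.trans hLU⟩, h01, fun x hx => ?_⟩
    exact (eventually_nhdsSet_iff_forall.1 h1) x hx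
  have hψ : ContDiff ℝ 1 (fun x => χ x • φ x) := by
    rw [contDiff_iff_contDiffAt]
    intro x
    by_cases hx : x ∈ U
    · exact hχsmooth.contDiffAt.smul (hφ.contDiffAt (hU.mem_nhds hx))
    · have : (fun x => χ x • φ x) =ᶠ[𝓝 x] fun _ => 0 := by
        have := notMem_tsupport_iff_eventuallyEq.1 fun h => hx (hχc.2 h)
        filter_upwards [this] with y hy
        simp [hy]
      exact contDiffAt_const.congr_of_eventuallyEq this
  have hint : ∫ x in E, vecDiv φ x = ∫ x in E, vecDiv (fun x => χ x • φ x) x := by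
    refine setIntegral_congr_fun hE fun x hx => vecDiv_congr ?_
    filter_upwards [hχ1 x (hEK hx)] with y hy
    simp [hy]
  rw [hint]
  refine ofReal_integral_vecDiv_le_per hψ hχc.1.smul_right (fun x => ?_) E
  by_cases hx : x ∈ U
  · rw [norm_smul, Real.norm_of_nonneg (hχ01 x).1]
    exact mul_le_one₀ (hχ01 x).2 (norm_nonneg _) (hb x hx)
  · have : χ x = 0 := by_contra fun h => hx (hχc.2 (subset_tsupport _ h))
    simp [this]

end Perimeter

section Cut

variable {n : ℕ}

lemma contDiff_sq_sub_norm_sq (p : EuclideanSpace ℝ (Fin n)) (r : ℝ) :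
    ContDiff ℝ 1 fun x : EuclideanSpace ℝ (Fin n) => r ^ 2 - ‖x - p‖ ^ 2 :=
  contDiff_const.sub ((contDiff_id.sub contDiff_const).norm_sq ℝ)

lemma fderiv_sq_sub_norm_sq (p x v : EuclideanSpace ℝ (Fin n)) (r : ℝ) :
    fderiv ℝ (fun x : EuclideanSpace ℝ (Fin n) => r ^ 2 - ‖x - p‖ ^ 2) x v =
      -(2 * inner ℝ (x - p) v) := by
  have h : HasFDerivAt (fun x : EuclideanSpace ℝ (Fin n) => r ^ 2 - ‖x - p‖ ^ 2) _ x :=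
    (((hasFDerivAt_id x).sub_const p).norm_sq).const_sub (r ^ 2)
  rw [h.fderiv]
  simp [inner_sub_left]

lemma setOf_pos_sq_sub_norm_sq (p : EuclideanSpace ℝ (Fin n)) {r : ℝ} (hr : 0 ≤ r) :
    {x | 0 < r ^ 2 - ‖x - p‖ ^ 2} = ball p r := by
  ext x
  rw [Set.mem_ofPred_eq, mem_ball, dist_eq_norm, sub_pos, sq_lt_sq₀ (norm_nonneg _) hr]

lemma contDiffAt_radial {p x : EuclideanSpace ℝ (Fin n)} (hx : x ≠ p) :
    ContDiffAt ℝ 1 (fun y : EuclideanSpace ℝ (Fin n) => ‖y - p‖⁻¹ • (y - p)) x := by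
  have h : ContDiffAt ℝ 1 (fun y : EuclideanSpace ℝ (Fin n) => y - p) x :=
    contDiffAt_id.sub contDiffAt_const
  exact ((h.norm ℝ (sub_ne_zero.2 hx)).inv (norm_ne_zero_iff.2 (sub_ne_zero.2 hx))).smul h

lemma vecDiv_radial {p x : EuclideanSpace ℝ (Fin n)} (hx : x ≠ p) :
    vecDiv (fun y : EuclideanSpace ℝ (Fin n) => ‖y - p‖⁻¹ • (y - p)) x = (n - 1) / ‖x - p‖ := by
  have hne : ‖x - p‖ ≠ 0 := norm_ne_zero_iff.2 (sub_ne_zero.2 hx)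
  have hn : DifferentiableAt ℝ (fun z : EuclideanSpace ℝ (Fin n) => ‖z‖) (x - p) :=
    differentiableAt_id.norm ℝ (sub_ne_zero.2 hx)
  have hN : HasFDerivAt (fun y : EuclideanSpace ℝ (Fin n) => ‖y - p‖)
      (fderiv ℝ (fun z : EuclideanSpace ℝ (Fin n) => ‖z‖) (x - p)) x :=
    hn.hasFDerivAt.comp x ((hasFDerivAt_id x).sub_const p)
  have hI : HasFDerivAt (fun y : EuclideanSpace ℝ (Fin n) => ‖y - p‖⁻¹)
      (-(‖x - p‖ ^ 2)⁻¹ • fderiv ℝ (fun z : EuclideanSpace ℝ (Fin n) => ‖z‖) (x - p)) x :=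
    (hasDerivAt_inv hne).comp_hasFDerivAt x hN
  have hself : fderiv ℝ (fun z : EuclideanSpace ℝ (Fin n) => ‖z‖) (x - p) (x - p) = ‖x - p‖ :=
    hn.fderiv_norm_self
  rw [vecDiv_smul hI.differentiableAt (by fun_prop), vecDiv_sub_const, hI.fderiv]
  simp only [smul_apply, hself, smul_eq_mul]
  field_simp
  ring

/-- Interpolating between a test field and the unit radial field across a sphere does not decrease
the divergence, since the cutoff is radially decreasing. -/
lemma le_vecDiv_interpolation {φ : EuclideanSpace ℝ (Fin n) → EuclideanSpace ℝ (Fin n)}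
    {p x : EuclideanSpace ℝ (Fin n)} (hx : x ≠ p) (hφ : DifferentiableAt ℝ φ x) (hb : ‖φ x‖ ≤ 1)
    (r : ℝ) {h : ℝ} (hh : 0 < h) :
    Real.smoothTransition ((r ^ 2 - ‖x - p‖ ^ 2) / h) * (vecDiv φ x - (n - 1) / ‖x - p‖)
        + (n - 1) / ‖x - p‖ ≤
      vecDiv (fun y => Real.smoothTransition ((r ^ 2 - ‖y - p‖ ^ 2) / h) •
        (φ y - ‖y - p‖⁻¹ • (y - p)) + ‖y - p‖⁻¹ • (y - p)) x := by
  have hu := (contDiffAt_radial hx).differentiableAt one_ne_zero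
  have hf : DifferentiableAt ℝ (fun y : EuclideanSpace ℝ (Fin n) => r ^ 2 - ‖y - p‖ ^ 2) x :=
    (contDiff_sq_sub_norm_sq p r).differentiable one_ne_zero x
  have hS := differentiableAt_smoothTransition_div hf h
  have hne : ‖x - p‖ ≠ 0 := norm_ne_zero_iff.2 (sub_ne_zero.2 hx)
  rw [vecDiv_add (hS.fun_smul (hφ.fun_sub hu)) hu, vecDiv_smul hS (hφ.fun_sub hu), vecDiv_sub hφ hu,
    vecDiv_radial hx, fderiv_smoothTransition_div hf, fderiv_sq_sub_norm_sq]
  have h1 : 0 ≤ deriv Real.smoothTransition ((r ^ 2 - ‖x - p‖ ^ 2) / h) :=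
    Real.smoothTransition.monotone.deriv_nonneg
  have h2 : inner ℝ (x - p) (φ x - ‖x - p‖⁻¹ • (x - p)) ≤ 0 := by
    rw [inner_sub_right, inner_smul_right, real_inner_self_eq_norm_sq]
    have h3 : inner ℝ (x - p) (φ x) ≤ ‖x - p‖ * ‖φ x‖ := real_inner_le_norm _ _
    have h4 : ‖x - p‖ * ‖φ x‖ ≤ ‖x - p‖ := mul_le_of_le_one_right (norm_nonneg _) hb
    have h5 : ‖x - p‖⁻¹ * ‖x - p‖ ^ 2 = ‖x - p‖ := by field_simp
    linarith
  have h6 : 0 ≤ deriv Real.smoothTransition ((r ^ 2 - ‖x - p‖ ^ 2) / h) *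
      (-(2 * inner ℝ (x - p) (φ x - ‖x - p‖⁻¹ • (x - p))) / h) :=
    mul_nonneg h1 (div_nonneg (by linarith) hh.le)
  linarith

lemma ofReal_integral_inter_ball_add_le_per (hn : 1 ≤ n) {p : EuclideanSpace ℝ (Fin n)}
    {E K : Set (EuclideanSpace ℝ (Fin n))} (hE : MeasurableSet E) (hEK : E ⊆ K) (hK : IsCompact K)
    (hp : p ∉ K) {R : ℝ} (hR : K ⊆ closedBall p R) {r : ℝ} (hr : 0 ≤ r)
    {φ : EuclideanSpace ℝ (Fin n) → EuclideanSpace ℝ (Fin n)} (hφ : ContDiff ℝ 1 φ)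
    (hc : HasCompactSupport φ) (hb : ∀ x, ‖φ x‖ ≤ 1) :
    ENNReal.ofReal ((∫ x in E ∩ ball p r, vecDiv φ x)
      + (n - 1) / R * volume.real (E \ ball p r)) ≤ per E := by
  have hn' : (0 : ℝ) ≤ n - 1 := by simpa using hn
  have hEfin : volume E ≠ ∞ := measure_ne_top_of_subset hEK hK.measure_ne_top
  have hint : IntegrableOn (fun x => vecDiv φ x - (n - 1) / R) E :=
    (integrable_vecDiv hφ hc).integrableOn.sub (integrableOn_const hEfin)
  have hcont : Continuous fun x : EuclideanSpace ℝ (Fin n) => r ^ 2 - ‖x - p‖ ^ 2 :=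
    (contDiff_sq_sub_norm_sq p r).continuous
  have hlim := (tendsto_integral_smoothTransition_mul hcont hint).add_const
    (∫ x in E, ((n - 1) / R : ℝ))
  have hval : (∫ x in {x | 0 < r ^ 2 - ‖x - p‖ ^ 2}, (vecDiv φ x - (n - 1) / R)
        ∂(volume.restrict E)) + ∫ x in E, ((n - 1) / R : ℝ) =
      (∫ x in E ∩ ball p r, vecDiv φ x) + (n - 1) / R * volume.real (E \ ball p r) := by
    rw [setOf_pos_sq_sub_norm_sq p hr, Measure.restrict_restrict measurableSet_ball,
      Set.inter_comm, integral_sub (integrable_vecDiv hφ hc).integrableOn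
        (integrableOn_const (measure_ne_top_of_subset Set.inter_subset_left hEfin)),
      setIntegral_const, setIntegral_const,
      ← measureReal_inter_add_sdiff (s := E) measurableSet_ball hEfin]
    simp only [smul_eq_mul]
    ring
  rw [hval] at hlim
  refine le_of_tendsto ((ENNReal.continuous_ofReal.tendsto _).comp hlim) ?_
  filter_upwards [self_mem_nhdsWithin] with h hh
  have hU : IsOpen ({p}ᶜ : Set (EuclideanSpace ℝ (Fin n))) := isOpen_compl_singleton
  have hKU : K ⊆ {p}ᶜ := fun x hx h => hp (h ▸ hx)
  have hψ : ContDiffOn ℝ 1 (fun y => Real.smoothTransition ((r ^ 2 - ‖y - p‖ ^ 2) / h) •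
      (φ y - ‖y - p‖⁻¹ • (y - p)) + ‖y - p‖⁻¹ • (y - p)) {p}ᶜ := fun x hx =>
    ((((contDiff_smoothTransition_div (contDiff_sq_sub_norm_sq p r) h).contDiffAt).smul
      (hφ.contDiffAt.sub (contDiffAt_radial hx))).add (contDiffAt_radial hx)).contDiffWithinAt
  refine le_trans (ENNReal.ofReal_le_ofReal ?_)
    (ofReal_integral_vecDiv_le_per_of_contDiffOn hE hEK hK hU hKU hψ fun x hx => ?_)
  · have hSint : IntegrableOn (fun x => Real.smoothTransition ((r ^ 2 - ‖x - p‖ ^ 2) / h) *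
        (vecDiv φ x - (n - 1) / R)) E :=
      hint.bdd_mul (c := 1) (contDiff_smoothTransition_div (contDiff_sq_sub_norm_sq p r)
        h).continuous.aestronglyMeasurable (by
          filter_upwards with x
          rw [Real.norm_of_nonneg (Real.smoothTransition.nonneg _)]
          exact Real.smoothTransition.le_one _)
    beta_reduce
    rw [← integral_add hSint (integrableOn_const hEfin)]
    refine setIntegral_mono_on (hSint.add (integrableOn_const hEfin))
      ((((continuousOn_vecDiv hU hψ).mono hKU).integrableOn_compact hK).mono_set hEK) hE
      fun x hx => ?_
    have hxp : x ≠ p := hKU (hEK hx)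
    refine le_trans ?_ (le_vecDiv_interpolation hxp (hφ.differentiable one_ne_zero x) (hb x) r hh)
    have hρ : 0 < ‖x - p‖ := norm_pos_iff.2 (sub_ne_zero.2 hxp)
    have hρR : ‖x - p‖ ≤ R := by simpa [dist_eq_norm] using hR (hEK hx)
    have hle : ((n : ℝ) - 1) / R ≤ (n - 1) / ‖x - p‖ := div_le_div_of_nonneg_left hn' hρ hρR
    nlinarith [Real.smoothTransition.le_one ((r ^ 2 - ‖x - p‖ ^ 2) / h)]
  · have hxp : ‖x - p‖ ≠ 0 := norm_ne_zero_iff.2 (sub_ne_zero.2 hx)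
    set s := Real.smoothTransition ((r ^ 2 - ‖x - p‖ ^ 2) / h)
    have hs0 : 0 ≤ s := Real.smoothTransition.nonneg _
    have hs1 : s ≤ 1 := Real.smoothTransition.le_one _
    have hu : ‖‖x - p‖⁻¹ • (x - p)‖ ≤ 1 := by
      rw [norm_smul, norm_inv, norm_norm, inv_mul_cancel₀ hxp]
    have hconv := convex_closedBall (0 : EuclideanSpace ℝ (Fin n)) 1
      (mem_closedBall_zero_iff.2 (hb x)) (mem_closedBall_zero_iff.2 hu) hs0
      (sub_nonneg.2 hs1) (add_sub_cancel _ _)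
    rw [mem_closedBall_zero_iff] at hconv
    refine le_of_eq_of_le (congrArg norm ?_) hconv
    module

/-- Intersecting with a ball whose centre lies off the ambient compact set decreases the
perimeter by at least a fixed multiple of the volume removed. -/
lemma per_inter_ball_add_le (hn : 1 ≤ n) {p : EuclideanSpace ℝ (Fin n)}
    {E K : Set (EuclideanSpace ℝ (Fin n))} (hE : MeasurableSet E) (hEK : E ⊆ K) (hK : IsCompact K)
    (hp : p ∉ K) {R : ℝ} (hR : K ⊆ closedBall p R) {r : ℝ} (hr : 0 ≤ r) (hR0 : 0 ≤ R) :
    per (E ∩ ball p r) + ENNReal.ofReal ((n - 1) / R * volume.real (E \ ball p r)) ≤ per E := by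
  have hn' : (0 : ℝ) ≤ n - 1 := by simpa using hn
  have hc0 : 0 ≤ (n - 1) / R * volume.real (E \ ball p r) := by positivity
  have hle : ENNReal.ofReal ((n - 1) / R * volume.real (E \ ball p r)) ≤ per E := by
    have := ofReal_integral_inter_ball_add_le_per hn hE hEK hK hp hR hr (φ := fun _ => 0)
      contDiff_const HasCompactSupport.zero (by simp)
    simpa [vecDiv] using this
  refine (add_le_add_left (per_le (P := per E -
    ENNReal.ofReal ((n - 1) / R * volume.real (E \ ball p r))) fun φ hφ hc hb => ?_) _).trans
    (tsub_add_cancel_of_le hle).le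
  refine ENNReal.le_sub_of_add_le_right ENNReal.ofReal_ne_top ?_
  rcases le_total 0 (∫ x in E ∩ ball p r, vecDiv φ x) with h | h
  · rw [← ENNReal.ofReal_add h hc0]
    exact ofReal_integral_inter_ball_add_le_per hn hE hEK hK hp hR hr hφ hc hb
  · rw [ENNReal.ofReal_of_nonpos h, zero_add]
    exact hle

end Cut

section Superlevel

lemma deriv_smoothTransition_eq_zero {s : ℝ} (hs : s ∉ Set.Ioo 0 1) :
    deriv Real.smoothTransition s = 0 := by
  rcases le_or_gt s 0 with h | h
  · refine IsLocalMin.deriv_eq_zero (Eventually.of_forall fun y => ?_)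
    rw [Real.smoothTransition.zero_of_nonpos h]
    exact Real.smoothTransition.nonneg y
  · have h1 : 1 ≤ s := not_lt.1 fun h1 => hs ⟨h, h1⟩
    refine IsLocalMax.deriv_eq_zero (Eventually.of_forall fun y => ?_)
    rw [Real.smoothTransition.one_of_one_le h1]
    exact Real.smoothTransition.le_one y

lemma exists_bound_deriv_smoothTransition :
    ∃ C : ℝ, 0 ≤ C ∧ ∀ s, |deriv Real.smoothTransition s| ≤ C := by
  have hcont : Continuous (deriv Real.smoothTransition) :=
    (Real.smoothTransition.contDiff (n := 1)).continuous_deriv le_rfl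
  obtain ⟨C, hC⟩ := (isCompact_Icc (a := (0 : ℝ)) (b := 1)).exists_bound_of_continuousOn
    hcont.continuousOn
  refine ⟨max C 0, le_max_right _ _, fun s => ?_⟩
  by_cases hs : s ∈ Set.Ioo (0 : ℝ) 1
  · exact (hC s (Set.Ioo_subset_Icc_self hs)).trans (le_max_left _ _)
  · rw [deriv_smoothTransition_eq_zero hs, abs_zero]
    exact le_max_right _ _

variable {n : ℕ}

lemma per_empty : per (∅ : Set (EuclideanSpace ℝ (Fin n))) = 0 :=
  nonpos_iff_eq_zero.1 (per_le fun φ _ _ _ => by simp)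

/-- The fundamental identity behind `per_union_superlevel_le`: cutting a test field off inside a
set `E` costs only the integral outside `E` of the field against the gradient of the cutoff. -/
lemma integral_compl_smoothTransition_mul_vecDiv_add
    {E : Set (EuclideanSpace ℝ (Fin n))} (hE : MeasurableSet E)
    {f : EuclideanSpace ℝ (Fin n) → ℝ} (hf : ContDiff ℝ 1 f) (h : ℝ)
    {φ : EuclideanSpace ℝ (Fin n) → EuclideanSpace ℝ (Fin n)} (hφ : ContDiff ℝ 1 φ)
    (hc : HasCompactSupport φ) :
    (∫ x in Eᶜ, Real.smoothTransition (f x / h) * vecDiv φ x) + ∫ x in E, vecDiv φ x =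
      (∫ x in E, vecDiv (fun x => φ x - Real.smoothTransition (f x / h) • φ x) x) -
        ∫ x in Eᶜ, deriv Real.smoothTransition (f x / h) * (fderiv ℝ f x (φ x) / h) := by
  have hdiv := integrable_vecDiv hφ hc
  have hS : ContDiff ℝ 1 fun x => Real.smoothTransition (f x / h) :=
    contDiff_smoothTransition_div hf h
  have hfd := hf.differentiable one_ne_zero
  have hSd := hS.differentiable one_ne_zero
  have hφd := hφ.differentiable one_ne_zero
  have hSφ : ContDiff ℝ 1 fun x => Real.smoothTransition (f x / h) • φ x := hS.smul hφ
  have hSφc : HasCompactSupport fun x => Real.smoothTransition (f x / h) • φ x :=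
    hc.mono fun x hx h0 => hx (by simp only [h0, smul_zero])
  have hSφi := integrable_vecDiv hSφ hSφc
  have hSdiv : Integrable fun x => Real.smoothTransition (f x / h) * vecDiv φ x :=
    hdiv.bdd_mul (c := 1) hS.continuous.aestronglyMeasurable (by
      filter_upwards with x
      rw [Real.norm_of_nonneg (Real.smoothTransition.nonneg _)]
      exact Real.smoothTransition.le_one _)
  have hprod (x) : vecDiv (fun x => Real.smoothTransition (f x / h) • φ x) x =
      Real.smoothTransition (f x / h) * vecDiv φ x +
        deriv Real.smoothTransition (f x / h) * (fderiv ℝ f x (φ x) / h) := by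
    rw [vecDiv_smul (hSd x) (hφd x), fderiv_smoothTransition_div (hfd x)]
  have hDi : Integrable fun x =>
      deriv Real.smoothTransition (f x / h) * (fderiv ℝ f x (φ x) / h) := by
    refine (hSφi.sub hSdiv).congr (Eventually.of_forall fun x => ?_)
    simp [hprod]
  have h1 : ∫ x in E, vecDiv (fun x => φ x - Real.smoothTransition (f x / h) • φ x) x =
      (∫ x in E, vecDiv φ x) -
        ∫ x in E, vecDiv (fun x => Real.smoothTransition (f x / h) • φ x) x := by
    rw [← integral_sub hdiv.integrableOn hSφi.integrableOn]
    exact integral_congr_ae (Eventually.of_forall fun x =>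
      vecDiv_sub (hφd x) (hSφ.differentiable one_ne_zero x))
  have h2 := integral_add_compl hE hSφi
  rw [integral_vecDiv_eq_zero hSφ hSφc] at h2
  have h3 : ∫ x in Eᶜ, vecDiv (fun x => Real.smoothTransition (f x / h) • φ x) x =
      (∫ x in Eᶜ, Real.smoothTransition (f x / h) * vecDiv φ x) +
        ∫ x in Eᶜ, deriv Real.smoothTransition (f x / h) * (fderiv ℝ f x (φ x) / h) := by
    rw [← integral_add hSdiv.integrableOn hDi.integrableOn]
    exact integral_congr_ae (Eventually.of_forall hprod)
  linarith

/-- The error term in `integral_compl_smoothTransition_mul_vecDiv_add` is controlled by the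
gradient of `f` and the volume of the layer where the cutoff varies. -/
lemma neg_setIntegral_deriv_smoothTransition_le {C : ℝ}
    (hC : ∀ s, |deriv Real.smoothTransition s| ≤ C)
    {S : Set (EuclideanSpace ℝ (Fin n))} (hS : MeasurableSet S)
    {f : EuclideanSpace ℝ (Fin n) → ℝ} {L M : ℝ} (hL0 : 0 ≤ L) (hM0 : 0 ≤ M)
    (hL : ∀ x, 0 < f x → ‖fderiv ℝ f x‖ ≤ L) {h : ℝ} (hh : 0 < h)
    (hM : volume {x | 0 < f x ∧ f x < h} ≤ ENNReal.ofReal (M * h))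
    {φ : EuclideanSpace ℝ (Fin n) → EuclideanSpace ℝ (Fin n)} (hb : ∀ x, ‖φ x‖ ≤ 1) :
    -∫ x in S, deriv Real.smoothTransition (f x / h) * (fderiv ℝ f x (φ x) / h) ≤ C * L * M := by
  have hC0 : 0 ≤ C := (abs_nonneg _).trans (hC 0)
  set D : EuclideanSpace ℝ (Fin n) → ℝ := fun x =>
    deriv Real.smoothTransition (f x / h) * (fderiv ℝ f x (φ x) / h) with hDdef
  have hsub : ∫ x in S ∩ {x | 0 < f x ∧ f x < h}, D x = ∫ x in S, D x := by
    refine (setIntegral_eq_of_subset_of_forall_sdiff_eq_zero hS Set.inter_subset_left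
      fun x hx => ?_).symm
    have : f x / h ∉ Set.Ioo (0 : ℝ) 1 := fun hI =>
      hx.2 ⟨hx.1, (div_pos_iff_of_pos_right hh).1 hI.1, (div_lt_one hh).1 hI.2⟩
    simp [hDdef, deriv_smoothTransition_eq_zero this]
  have hvol : volume (S ∩ {x | 0 < f x ∧ f x < h}) ≤ ENNReal.ofReal (M * h) :=
    (measure_mono Set.inter_subset_right).trans hM
  have hbound := norm_setIntegral_le_of_norm_le_const (f := D) (C := C * (L / h))
    (hvol.trans_lt ENNReal.ofReal_lt_top) (fun x hx => by
      rw [hDdef, norm_mul, norm_div, Real.norm_of_nonneg hh.le]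
      refine mul_le_mul (hC _) ?_ (by positivity) hC0
      refine div_le_div_of_nonneg_right ?_ hh.le
      exact ((fderiv ℝ f x).le_opNorm _).trans
        ((mul_le_of_le_one_right (norm_nonneg _) (hb x)).trans (hL x hx.2.1)))
  rw [hsub] at hbound
  calc -∫ x in S, D x ≤ ‖∫ x in S, D x‖ := neg_le_abs _
    _ ≤ C * (L / h) * volume.real (S ∩ {x | 0 < f x ∧ f x < h}) := hbound
    _ ≤ C * (L / h) * (M * h) := by
      refine mul_le_mul_of_nonneg_left ?_ (by positivity)
      exact ENNReal.toReal_le_of_le_ofReal (by positivity) hvol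
    _ = C * L * M := by field_simp

/-- If `|∇f|` is at most `L` where `f` is positive and the layers `{0 < f < h}` have volume at
most `M * h`, then joining the superlevel set `{0 < f}` to a set increases its perimeter by at most
a multiple of `L * M`. -/
lemma per_union_superlevel_le {C : ℝ} (hC : ∀ s, |deriv Real.smoothTransition s| ≤ C)
    {E : Set (EuclideanSpace ℝ (Fin n))} (hE : MeasurableSet E)
    {f : EuclideanSpace ℝ (Fin n) → ℝ} (hf : ContDiff ℝ 1 f) {L M : ℝ} (hL0 : 0 ≤ L) (hM0 : 0 ≤ M)
    (hL : ∀ x, 0 < f x → ‖fderiv ℝ f x‖ ≤ L)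
    (hM : ∀ᶠ h in 𝓝[>] (0 : ℝ), volume {x | 0 < f x ∧ f x < h} ≤ ENNReal.ofReal (M * h)) :
    per (E ∪ {x | 0 < f x}) ≤ per E + ENNReal.ofReal (C * L * M) := by
  refine per_le fun φ hφ hc hb => ?_
  have hdiv := integrable_vecDiv hφ hc
  have hlim := (tendsto_integral_smoothTransition_mul hf.continuous
    (hdiv.integrableOn (s := Eᶜ))).add_const (∫ x in E, vecDiv φ x)
  have hval : (∫ x in {x | 0 < f x}, vecDiv φ x ∂(volume.restrict Eᶜ)) + ∫ x in E, vecDiv φ x =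
      ∫ x in E ∪ {x | 0 < f x}, vecDiv φ x := by
    have hD : MeasurableSet {x | 0 < f x} :=
      (isOpen_lt continuous_const hf.continuous).measurableSet
    rw [Measure.restrict_restrict hD, add_comm, ← setIntegral_union
      (Set.disjoint_left.2 fun x hx hx' => hx'.2 hx) (hD.inter hE.compl)
      hdiv.integrableOn hdiv.integrableOn, ← Set.sdiff_eq, Set.union_sdiff_self]
  rw [hval] at hlim
  refine le_of_tendsto ((ENNReal.continuous_ofReal.tendsto _).comp hlim) ?_
  filter_upwards [self_mem_nhdsWithin, hM] with h hh hMh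
  rw [Set.mem_Ioi] at hh
  have hS : ContDiff ℝ 1 fun x => Real.smoothTransition (f x / h) :=
    contDiff_smoothTransition_div hf h
  have hSφ : ContDiff ℝ 1 fun x => Real.smoothTransition (f x / h) • φ x := hS.smul hφ
  have hSφc : HasCompactSupport fun x => Real.smoothTransition (f x / h) • φ x :=
    hc.mono fun x hx h0 => hx (by simp only [h0, smul_zero])
  have hψ : ContDiff ℝ 1 fun x => φ x - Real.smoothTransition (f x / h) • φ x := hφ.sub hSφ
  have hψc : HasCompactSupport fun x => φ x - Real.smoothTransition (f x / h) • φ x :=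
    hc.sub hSφc
  have hψb (x) : ‖φ x - Real.smoothTransition (f x / h) • φ x‖ ≤ 1 := by
    have h0 := Real.smoothTransition.nonneg (f x / h)
    have h1 := Real.smoothTransition.le_one (f x / h)
    rw [show φ x - Real.smoothTransition (f x / h) • φ x =
      (1 - Real.smoothTransition (f x / h)) • φ x by module, norm_smul,
      Real.norm_of_nonneg (by linarith)]
    exact mul_le_one₀ (by linarith) (norm_nonneg _) (hb x)
  have hDle := neg_setIntegral_deriv_smoothTransition_le hC hE.compl hL0 hM0 hL hh hMh hb
  simp only [Function.comp_apply]
  rw [integral_compl_smoothTransition_mul_vecDiv_add hE hf h hφ hc]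
  refine (ENNReal.ofReal_le_ofReal (show _ ≤
    (∫ x in E, vecDiv (fun x => φ x - Real.smoothTransition (f x / h) • φ x) x)
      + C * L * M by linarith)).trans (ENNReal.ofReal_add_le.trans ?_)
  exact add_le_add_left (ofReal_integral_vecDiv_le_per hψ hψc hψb E) _

/-- Joining a ball of radius `r` to a set increases its perimeter by `O(r ^ (n - 1))`. -/
lemma exists_per_union_ball_le (n : ℕ) (hn : 1 ≤ n) :
    ∃ C : ℝ, 0 ≤ C ∧ ∀ (E : Set (EuclideanSpace ℝ (Fin n))) (p : EuclideanSpace ℝ (Fin n)) (r : ℝ),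
      MeasurableSet E → 0 < r →
        per (E ∪ ball p r) ≤ per E + ENNReal.ofReal (C * r ^ (n - 1)) := by
  obtain ⟨C, hC0, hC⟩ := exists_bound_deriv_smoothTransition
  set ω := volume.real (ball (0 : EuclideanSpace ℝ (Fin n)) 1) with hω
  refine ⟨C * 2 * (ω * n), by positivity, fun E p r hE hr => ?_⟩
  have hfd (x : EuclideanSpace ℝ (Fin n)) (hx : 0 < r ^ 2 - ‖x - p‖ ^ 2) :
      ‖fderiv ℝ (fun x : EuclideanSpace ℝ (Fin n) => r ^ 2 - ‖x - p‖ ^ 2) x‖ ≤ 2 * r := by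
    have hxr : ‖x - p‖ ≤ r := ((sq_lt_sq₀ (norm_nonneg _) hr.le).1 (sub_pos.1 hx)).le
    refine ContinuousLinearMap.opNorm_le_bound _ (by positivity) fun v => ?_
    rw [fderiv_sq_sub_norm_sq, norm_neg, norm_mul, Real.norm_two, mul_assoc]
    refine mul_le_mul_of_nonneg_left ?_ zero_le_two
    exact (norm_inner_le_norm _ _).trans (mul_le_mul_of_nonneg_right hxr (norm_nonneg _))
  have : Nontrivial (EuclideanSpace ℝ (Fin n)) :=
    Module.nontrivial_of_finrank_pos (R := ℝ) (by rw [finrank_euclideanSpace_fin]; exact hn)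
  have hvolball (s : ℝ) (hs : 0 ≤ s) : volume.real (ball p s) = s ^ n * ω := by
    rw [measureReal_def, Measure.addHaar_ball _ _ hs, ENNReal.toReal_mul,
      ENNReal.toReal_ofReal (by positivity), finrank_euclideanSpace_fin, hω, measureReal_def]
  have hlayer : ∀ᶠ h in 𝓝[>] (0 : ℝ), volume {x : EuclideanSpace ℝ (Fin n) |
      0 < r ^ 2 - ‖x - p‖ ^ 2 ∧ r ^ 2 - ‖x - p‖ ^ 2 < h} ≤
        ENNReal.ofReal (ω * n * r ^ (n - 1) / r * h) := by
    filter_upwards [Ioo_mem_nhdsGT (show (0 : ℝ) < r ^ 2 by positivity)] with h hh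
    have hδ1 : h / r < r := by rw [div_lt_iff₀ hr]; nlinarith [hh.2]
    have hδ0 : 0 < h / r := div_pos hh.1 hr
    have hsub : {x : EuclideanSpace ℝ (Fin n) |
        0 < r ^ 2 - ‖x - p‖ ^ 2 ∧ r ^ 2 - ‖x - p‖ ^ 2 < h} ⊆ ball p r \ ball p (r - h / r) := by
      intro x hx
      refine ⟨(setOf_pos_sq_sub_norm_sq p hr.le).subset hx.1, fun hx' => ?_⟩
      rw [mem_ball, dist_eq_norm] at hx'
      have h1 : ‖x - p‖ ^ 2 < (r - h / r) ^ 2 :=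
        (sq_lt_sq₀ (norm_nonneg _) (by linarith)).2 hx'
      have h2 : h / r * r = h := by field_simp
      have h3 : h / r * (h / r) ≤ h / r * r := mul_le_mul_of_nonneg_left hδ1.le hδ0.le
      nlinarith [hx.2]
    refine (measure_mono hsub).trans ?_
    rw [← ENNReal.ofReal_toReal (measure_ne_top_of_subset Set.sdiff_subset
      (measure_ball_lt_top (μ := volume) (x := p) (r := r)).ne)]
    refine ENNReal.ofReal_le_ofReal ?_
    rw [← measureReal_def, measureReal_sdiff (ball_subset_ball (by linarith)) measurableSet_ball
      measure_ball_lt_top.ne, hvolball r hr.le, hvolball _ (by linarith)]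
    have hbern := one_add_mul_le_pow (a := -(h / r / r)) (by
      have : h / r / r < 1 := (div_lt_one hr).2 hδ1
      linarith) n
    have hpow : (r - h / r) ^ n = r ^ n * (1 + -(h / r / r)) ^ n := by
      rw [← mul_pow]; congr 1; field_simp; ring
    have hrn : r ^ n = r ^ (n - 1) * r := by rw [← pow_succ, Nat.sub_add_cancel hn]
    calc r ^ n * ω - (r - h / r) ^ n * ω = r ^ n * ω * (1 - (1 + -(h / r / r)) ^ n) := by
          rw [hpow]; ring
      _ ≤ r ^ n * ω * (n * (h / r / r)) := by
          refine mul_le_mul_of_nonneg_left ?_ (by positivity)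
          linarith
      _ = ω * n * r ^ (n - 1) / r * h := by rw [hrn]; field_simp
  have := per_union_superlevel_le hC hE (contDiff_sq_sub_norm_sq p r) (by positivity)
    (by positivity) hfd hlayer
  rw [setOf_pos_sq_sub_norm_sq p hr.le] at this
  refine this.trans_eq ?_
  congr 2
  field_simp

/-- Open sets can be exhausted in volume by sets of finite perimeter. -/
lemma exists_per_lt_top {G : Set (EuclideanSpace ℝ (Fin n))} (hG : IsOpen G) {A : ℝ≥0∞}
    (hA : A < volume G) : ∃ E ⊆ G, MeasurableSet E ∧ A < volume E ∧ per E < ∞ := by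
  obtain ⟨K, hKG, hK, hAK⟩ := hG.exists_lt_isCompact hA
  obtain ⟨L, hL, hKL, hLG⟩ := exists_compact_between hK hG hKG
  obtain ⟨χ, h1, h0, h01⟩ := exists_contMDiffMap_one_nhds_of_subset_interior
    (modelWithCornersSelf ℝ (EuclideanSpace ℝ (Fin n))) (n := 1) hK.isClosed hKL
  have hχ : ContDiff ℝ 1 χ := χ.contMDiff.contDiff
  have hχc : HasCompactSupport χ := HasCompactSupport.intro hL h0
  have hLfin : volume L ≠ ∞ := hL.measure_ne_top
  set m : ℝ → ℝ := fun t => volume.real ({x | t < χ x} ∩ L) with hm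
  have hanti : Antitone m := fun s t hst => measureReal_mono
    (Set.inter_subset_inter_left _ fun x (hx : t < χ x) => hst.trans_lt hx)
    (measure_ne_top_of_subset Set.inter_subset_right hLfin)
  obtain ⟨t, ht, htd⟩ : ∃ t ∈ Set.Ioo (0 : ℝ) 1, DifferentiableAt ℝ m t := by
    by_contra! hcon
    have hae := (hanti.neg).ae_differentiableAt
    have : Set.Ioo (0 : ℝ) 1 ⊆ {t | ¬ DifferentiableAt ℝ (fun t => -m t) t} := fun t ht h =>
      hcon t ht (by simpa using h.neg)
    have hz := measure_mono_null this hae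
    simp at hz
  obtain ⟨M, hM⟩ := htd.isBigO_sub.bound
  have hlayer : ∀ᶠ h in 𝓝[>] (0 : ℝ), volume {x | 0 < χ x - t ∧ χ x - t < h} ≤
      ENNReal.ofReal (max M 0 * h) := by
    have htend : Tendsto (fun h : ℝ => t + h) (𝓝[>] 0) (𝓝 t) := by
      have : Tendsto (fun h : ℝ => t + h) (𝓝 0) (𝓝 (t + 0)) :=
        (continuous_const.add continuous_id).tendsto 0
      rw [add_zero] at this
      exact this.mono_left nhdsWithin_le_nhds
    filter_upwards [htend.eventually hM, self_mem_nhdsWithin] with h hMh hh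
    rw [Set.mem_Ioi] at hh
    have hsub : {x | 0 < χ x - t ∧ χ x - t < h} ⊆
        ({x | t < χ x} ∩ L) \ ({x | t + h < χ x} ∩ L) := by
      rintro x ⟨hx1, hx2⟩
      refine ⟨⟨sub_pos.1 hx1, by_contra fun hx => ?_⟩, fun hx => ?_⟩
      · have := h0 x hx
        linarith [ht.1]
      · have : t + h < χ x := hx.1
        linarith
    have hsub' : {x | t + h < χ x} ∩ L ⊆ {x | t < χ x} ∩ L :=
      Set.inter_subset_inter_left _ fun x (hx : t + h < χ x) =>
        ((lt_add_of_pos_right t hh).trans hx : t < χ x)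
    have hmeas : MeasurableSet ({x | t + h < χ x} ∩ L) :=
      (isOpen_lt continuous_const hχ.continuous).measurableSet.inter hL.measurableSet
    refine (measure_mono hsub).trans ?_
    rw [← ENNReal.ofReal_toReal (measure_ne_top_of_subset
      (Set.sdiff_subset.trans Set.inter_subset_right) hLfin), ← measureReal_def,
      measureReal_sdiff hsub' hmeas (measure_ne_top_of_subset Set.inter_subset_right hLfin)]
    refine ENNReal.ofReal_le_ofReal ?_
    rw [add_sub_cancel_left, Real.norm_of_nonneg hh.le, Real.norm_eq_abs] at hMh
    calc m t - m (t + h) ≤ |m (t + h) - m t| := by rw [abs_sub_comm]; exact le_abs_self _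
      _ ≤ M * h := hMh
      _ ≤ max M 0 * h := mul_le_mul_of_nonneg_right (le_max_left _ _) hh.le
  obtain ⟨B, hB⟩ := (hχ.continuous_fderiv one_ne_zero).bounded_above_of_compact_support
    (hχc.fderiv ℝ)
  obtain ⟨C, -, hC⟩ := exists_bound_deriv_smoothTransition
  have hper := per_union_superlevel_le hC MeasurableSet.empty (hχ.sub (contDiff_const (c := t)))
    (L := max B 0) (M := max M 0) (le_max_right _ _) (le_max_right _ _)
    (fun x _ => by
      rw [fderiv_sub_const]
      exact (hB x).trans (le_max_left _ _)) hlayer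
  rw [per_empty, zero_add, Set.empty_union] at hper
  refine ⟨_, fun x hx => hLG (by_contra fun hxL => ?_),
    (isOpen_lt continuous_const (hχ.continuous.sub continuous_const)).measurableSet,
    hAK.trans_le (measure_mono fun x hx => ?_), hper.trans_lt ENNReal.ofReal_lt_top⟩
  · have h2 : 0 < χ x - t := hx
    have := h0 x hxL
    linarith [ht.1]
  · have := (eventually_nhdsSet_iff_forall.1 h1 x hx).self_of_nhds
    change 0 < χ x - t
    linarith [ht.2]

end Superlevel

section Profile

variable {n : ℕ}

/-- The volume of `S ∩ ball p r` attains every intermediate value as `r` varies. -/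
lemma exists_volume_inter_ball_eq (hn : 1 ≤ n) (S : Set (EuclideanSpace ℝ (Fin n)))
    (p : EuclideanSpace ℝ (Fin n)) {R : ℝ} (hR : 0 ≤ R) {A : ℝ≥0∞}
    (hA : A ≤ volume (S ∩ ball p R)) :
    ∃ r ∈ Set.Icc 0 R, volume (S ∩ ball p r) = A := by
  have : Nontrivial (EuclideanSpace ℝ (Fin n)) :=
    Module.nontrivial_of_finrank_pos (R := ℝ) (by rw [finrank_euclideanSpace_fin]; exact hn)
  have hfin (r : ℝ) : volume (S ∩ ball p r) ≠ ∞ :=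
    measure_ne_top_of_subset Set.inter_subset_right measure_ball_lt_top.ne
  set ω := volume.real (ball (0 : EuclideanSpace ℝ (Fin n)) 1) with hω
  have hvolball (s : ℝ) (hs : 0 ≤ s) : volume.real (ball p s) = s ^ n * ω := by
    rw [measureReal_def, Measure.addHaar_ball _ _ hs, ENNReal.toReal_mul,
      ENNReal.toReal_ofReal (by positivity), finrank_euclideanSpace_fin, hω, measureReal_def]
  set m : ℝ → ℝ := fun r => volume.real (S ∩ ball p r) with hm
  have hmono : Monotone m := fun s r hsr => measureReal_mono
    (Set.inter_subset_inter_right _ (ball_subset_ball hsr)) (hfin r)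
  have hle (s r : ℝ) (hs : 0 ≤ s) (hsr : s ≤ r) : |m r - m s| ≤ |r ^ n * ω - s ^ n * ω| := by
    rw [abs_of_nonneg (sub_nonneg.2 (hmono hsr)), ← hvolball s hs, ← hvolball r (hs.trans hsr)]
    refine le_trans ?_ (le_abs_self _)
    rw [← measureReal_sdiff (ball_subset_ball hsr) measurableSet_ball measure_ball_lt_top.ne,
      sub_le_iff_le_add]
    refine (measureReal_mono ?_ (measure_union_lt_top
      (measure_lt_top_of_subset Set.sdiff_subset measure_ball_lt_top.ne)
      (hfin s).lt_top).ne).trans (measureReal_union_le _ _)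
    rintro x ⟨hxS, hxr⟩
    by_cases hxs : x ∈ ball p s
    · exact Or.inr ⟨hxS, hxs⟩
    · exact Or.inl ⟨hxr, hxs⟩
  have hcont : ContinuousOn m (Set.Icc 0 R) := by
    intro s hs
    rw [ContinuousWithinAt, tendsto_iff_dist_tendsto_zero]
    have hb : Continuous fun r : ℝ => |r ^ n * ω - s ^ n * ω| := by fun_prop
    have hb0 : Tendsto (fun r : ℝ => |r ^ n * ω - s ^ n * ω|) (𝓝[Set.Icc 0 R] s) (𝓝 0) := by
      have := hb.tendsto s
      rw [sub_self, abs_zero] at this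
      exact this.mono_left nhdsWithin_le_nhds
    refine squeeze_zero' (Eventually.of_forall fun _ => dist_nonneg) ?_ hb0
    filter_upwards [self_mem_nhdsWithin] with r hr
    rw [Real.dist_eq]
    rcases le_total s r with h | h
    · exact hle s r hs.1 h
    · rw [abs_sub_comm, abs_sub_comm (r ^ n * ω)]
      exact hle r s hr.1 h
  obtain ⟨r, hr, hrA⟩ := intermediate_value_Icc hR hcont
    (show A.toReal ∈ Set.Icc (m 0) (m R) from
      ⟨by simp [hm], ENNReal.toReal_mono (hfin R) hA⟩)
  exact ⟨r, hr, (ENNReal.toReal_eq_toReal_iff' (hfin r) (ne_top_of_le_ne_top (hfin R) hA)).1 hrA⟩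

lemma isoProfile_le {G E : Set (EuclideanSpace ℝ (Fin n))} (hE : MeasurableSet E)
    (hEG : E ⊆ closure G) : isoProfile G (volume E) ≤ per E :=
  sInf_le ⟨E, hE, hEG, rfl, rfl⟩

lemma le_isoProfile {G : Set (EuclideanSpace ℝ (Fin n))} {A P : ℝ≥0∞}
    (h : ∀ E, MeasurableSet E → E ⊆ closure G → volume E = A → P ≤ per E) :
    P ≤ isoProfile G A :=
  le_sInf fun _ ⟨E, hE, hEG, hEA, hP⟩ => hP ▸ h E hE hEG hEA

lemma isoProfile_zero (G : Set (EuclideanSpace ℝ (Fin n))) : isoProfile G 0 = 0 := by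
  have := isoProfile_le (G := G) MeasurableSet.empty (Set.empty_subset _)
  rwa [measure_empty, per_empty, nonpos_iff_eq_zero] at this

/-- The isoperimetric profile of a bounded set increases at least linearly. -/
lemma exists_isoProfile_add_le (hn : 2 ≤ n) {G : Set (EuclideanSpace ℝ (Fin n))}
    (hG : Bornology.IsBounded G) :
    ∃ c : ℝ, 0 < c ∧ ∀ A B : ℝ≥0∞, A ≤ B →
      isoProfile G A + ENNReal.ofReal c * (B - A) ≤ isoProfile G B := by
  have hn1 : 1 ≤ n := one_le_two.trans hn
  have : Nontrivial (EuclideanSpace ℝ (Fin n)) :=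
    Module.nontrivial_of_finrank_pos (R := ℝ) (by rw [finrank_euclideanSpace_fin]; omega)
  have : NoncompactSpace (EuclideanSpace ℝ (Fin n)) :=
    NormedSpace.noncompactSpace ℝ (EuclideanSpace ℝ (Fin n))
  have hK : IsCompact (closure G) := hG.isCompact_closure
  obtain ⟨p, hp⟩ := (Set.ne_univ_iff_exists_notMem _).1 hK.ne_univ
  obtain ⟨R, hR0, hR⟩ := hK.isBounded.subset_closedBall_lt 0 p
  have hn' : (0 : ℝ) < n - 1 := by
    have : (2 : ℝ) ≤ n := by exact_mod_cast hn
    linarith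
  refine ⟨(n - 1) / R, div_pos hn' hR0, fun A B hAB => le_isoProfile fun E hE hEG hEB => ?_⟩
  have hBfin : volume E ≠ ∞ := measure_ne_top_of_subset hEG hK.measure_ne_top
  have hER : E ∩ ball p (R + 1) = E := Set.inter_eq_left.2
    (hEG.trans (hR.trans (closedBall_subset_ball (lt_add_one R))))
  obtain ⟨r, hr, hrA⟩ := exists_volume_inter_ball_eq hn1 E p (R := R + 1) (by linarith)
    (show A ≤ _ by rwa [hER, hEB])
  have hcut := per_inter_ball_add_le hn1 hE hEG hK hp hR hr.1 hR0.le
  have hdiff : volume (E \ ball p r) = B - A := by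
    have h := measure_inter_add_sdiff (μ := volume) E (measurableSet_ball (x := p) (ε := r))
    rw [hrA, hEB] at h
    exact ENNReal.eq_sub_of_add_eq' (hEB ▸ hBfin) (by rwa [add_comm])
  rw [measureReal_def, hdiff, ENNReal.ofReal_mul (by positivity),
    ENNReal.ofReal_toReal (ne_top_of_le_ne_top (hEB ▸ hBfin) tsub_le_self)] at hcut
  refine le_trans (add_le_add_left ?_ _) hcut
  rw [← hrA]
  exact isoProfile_le (hE.inter measurableSet_ball) (Set.inter_subset_left.trans hEG)

lemma isoProfile_mono (hn : 2 ≤ n) {G : Set (EuclideanSpace ℝ (Fin n))}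
    (hG : Bornology.IsBounded G) : Monotone (isoProfile G) := fun A B hAB => by
  obtain ⟨c, -, hc⟩ := exists_isoProfile_add_le hn hG
  exact le_self_add.trans (hc A B hAB)

lemma isoProfile_lt_top (hn : 2 ≤ n) {G : Set (EuclideanSpace ℝ (Fin n))} (hGo : IsOpen G)
    (hG : Bornology.IsBounded G) {A : ℝ≥0∞} (hA : A < volume G) : isoProfile G A < ∞ := by
  obtain ⟨E, hEG, hE, hAE, hper⟩ := exists_per_lt_top hGo hA
  exact ((isoProfile_mono hn hG hAE.le).trans
    (isoProfile_le hE (hEG.trans subset_closure))).trans_lt hper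

lemma isoProfile_lt_isoProfile (hn : 2 ≤ n) {G : Set (EuclideanSpace ℝ (Fin n))} (hGo : IsOpen G)
    (hG : Bornology.IsBounded G) {A B : ℝ≥0∞} (hA : A < volume G) (hAB : A < B) :
    isoProfile G A < isoProfile G B := by
  obtain ⟨c, hc0, hc⟩ := exists_isoProfile_add_le hn hG
  refine (ENNReal.lt_add_right (isoProfile_lt_top hn hGo hG hA).ne ?_).trans_le (hc A B hAB.le)
  exact mul_ne_zero (ENNReal.ofReal_pos.2 hc0).ne' (tsub_pos_of_lt hAB).ne'

/-- Lower semicontinuity of the perimeter at `G`: subsets of almost full volume have almost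
full perimeter. -/
lemma exists_forall_lt_isoProfile {G : Set (EuclideanSpace ℝ (Fin n))} (hGo : IsOpen G)
    (hGnull : volume (frontier G) = 0) (hG : Bornology.IsBounded G) {P : ℝ≥0∞} (hP : P < per G) :
    ∃ A₀ < volume G, ∀ A, A₀ ≤ A → P < isoProfile G A := by
  obtain ⟨φ, hφ, hc, hb, hI⟩ := exists_of_lt_per hP
  set I := ∫ x in G, vecDiv φ x with hIdef
  have hVfin : volume G ≠ ∞ := hG.measure_lt_top.ne
  have hI0 : 0 < I := ENNReal.ofReal_pos.1 (bot_le.trans_lt hI)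
  have hV0 : volume G ≠ 0 := fun h => hI0.ne' (by
    rw [hIdef, Measure.restrict_eq_zero.2 h, integral_zero_measure])
  have hPI : P.toReal < I := (ENNReal.lt_ofReal_iff_toReal_lt hI.ne_top).1 hI
  obtain ⟨C, hC⟩ := (continuous_vecDiv hφ).bounded_above_of_compact_support
    (hasCompactSupport_vecDiv hc)
  have hC0 : 0 ≤ C := (norm_nonneg _).trans (hC 0)
  set δ := (I - P.toReal) / (2 * (C + 1)) with hδ
  have hδ0 : 0 < δ := div_pos (by linarith) (by linarith)
  have hCδ : C * δ ≤ (I - P.toReal) / 2 := by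
    have : (C + 1) * δ = (I - P.toReal) / 2 := by rw [hδ]; field_simp
    linarith
  refine ⟨volume G - ENNReal.ofReal δ,
    ENNReal.sub_lt_self hVfin hV0 (ENNReal.ofReal_pos.2 hδ0).ne', fun A hA => ?_⟩
  have hlt : P < ENNReal.ofReal ((I + P.toReal) / 2) :=
    (ENNReal.lt_ofReal_iff_toReal_lt hI.ne_top).2 (by linarith)
  refine hlt.trans_le (le_isoProfile fun E hE hEG hEA => ?_)
  refine le_trans (ENNReal.ofReal_le_ofReal ?_) (ofReal_integral_vecDiv_le_per hφ hc hb E)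
  have hae : (G ∩ E : Set (EuclideanSpace ℝ (Fin n))) =ᵐ[volume] E := by
    have hempty := Set.sdiff_eq_empty.2 (Set.inter_subset_right (s := G) (t := E))
    refine ae_eq_set.2 ⟨by rw [hempty, measure_empty], measure_mono_null ?_ hGnull⟩
    rw [hGo.frontier_eq]
    exact fun x hx => ⟨hEG hx.1, fun hxG => hx.2 ⟨hxG, hx.1⟩⟩
  have hdiv := integrable_vecDiv hφ hc
  have hsplit := integral_inter_add_sdiff (s := G) hE (hdiv.integrableOn (s := G))
  rw [setIntegral_congr_set hae] at hsplit
  have hvol : volume (G \ E) ≤ ENNReal.ofReal δ := by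
    have h := measure_inter_add_sdiff (μ := volume) G hE
    rw [measure_congr hae, hEA] at h
    have hAfin : A ≠ ∞ := fun hA' => hVfin (by rw [← h, hA', top_add])
    rw [tsub_le_iff_right, ← h] at hA
    exact (ENNReal.add_le_add_iff_left hAfin).1 hA
  have hbound := norm_setIntegral_le_of_norm_le_const (f := vecDiv φ) (μ := volume)
    (hvol.trans_lt ENNReal.ofReal_lt_top) (fun x _ => hC x)
  have hle : volume.real (G \ E) ≤ δ := ENNReal.toReal_le_of_le_ofReal hδ0.le hvol
  have h1 : ∫ x in G \ E, vecDiv φ x ≤ C * δ :=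
    (le_abs_self _).trans (hbound.trans (mul_le_mul_of_nonneg_left hle hC0))
  linarith

/-- Below any volume less than that of `G`, a small amount of volume can be added at a small cost in
perimeter, uniformly. -/
lemma exists_isoProfile_le_add (hn : 2 ≤ n) {G : Set (EuclideanSpace ℝ (Fin n))} (hGo : IsOpen G)
    {B₀ : ℝ≥0∞} (hB₀ : B₀ < volume G) {ε : ℝ≥0∞} (hε : ε ≠ 0) :
    ∃ δ : ℝ≥0∞, δ ≠ 0 ∧ ∀ A B, A ≤ B → B ≤ B₀ → B ≤ A + δ →
      isoProfile G B ≤ isoProfile G A + ε := by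
  have hn1 : 1 ≤ n := one_le_two.trans hn
  obtain ⟨C, hC0, hC⟩ := exists_per_union_ball_le n hn1
  obtain ⟨K, hKG, hK, hB₀K⟩ := hGo.exists_lt_isCompact hB₀
  obtain ⟨ρ, hρ0, hρ⟩ := hK.exists_thickening_subset_open hGo hKG
  obtain ⟨r, hr0, hrρ, hrε⟩ : ∃ r : ℝ, 0 < r ∧ r ≤ ρ ∧ ENNReal.ofReal (C * r ^ (n - 1)) ≤ ε := by
    have hcont : Continuous fun r : ℝ => ENNReal.ofReal (C * r ^ (n - 1)) :=
      ENNReal.continuous_ofReal.comp (by fun_prop)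
    have ht := hcont.tendsto 0
    rw [zero_pow (by omega), mul_zero, ENNReal.ofReal_zero] at ht
    have hev := (ht.mono_left (nhdsWithin_le_nhds (s := Set.Ioi 0))).eventually
      (eventually_lt_nhds (pos_iff_ne_zero.2 hε))
    obtain ⟨r, hr1, hr2⟩ := (hev.and (Ioo_mem_nhdsGT hρ0)).exists
    exact ⟨r, hr2.1, hr2.2.le, hr1.le⟩
  obtain ⟨t, htK, ht, hKt⟩ := hK.finite_cover_balls hr0
  set κ := volume K - B₀ with hκ
  have hκ0 : κ ≠ 0 := (tsub_pos_of_lt hB₀K).ne'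
  have hκfin : κ ≠ ∞ := ne_top_of_le_ne_top hK.measure_ne_top tsub_le_self
  set N := ht.toFinset.card
  have hN0 : (N + 1 : ℝ≥0∞) ≠ 0 := by simp
  have hNfin : (N + 1 : ℝ≥0∞) ≠ ∞ := by simp
  have hδ0 : κ / (N + 1) ≠ 0 := (ENNReal.div_pos hκ0 hNfin).ne'
  have hδfin : κ / (N + 1) ≠ ∞ := ENNReal.div_ne_top hκfin hN0
  refine ⟨κ / (N + 1), hδ0, fun A B hAB hBB₀ hBA => ?_⟩
  rw [← tsub_le_iff_right]
  refine le_isoProfile fun E hE hEG hEA => ?_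
  rw [tsub_le_iff_right]
  obtain ⟨p, hpt, hp⟩ : ∃ p ∈ t, κ / (N + 1) ≤ volume (Eᶜ ∩ ball p r) := by
    by_contra! hcon
    have h1 : κ ≤ N * (κ / (N + 1)) := calc
      κ ≤ volume K - volume E := tsub_le_tsub_left (hEA.trans_le (hAB.trans hBB₀)) _
      _ ≤ volume (K \ E) := le_measure_sdiff
      _ ≤ volume (⋃ x ∈ ht.toFinset, Eᶜ ∩ ball x r) := measure_mono fun x hx => by
        obtain ⟨q, hq, hxq⟩ := Set.mem_iUnion₂.1 (hKt hx.1)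
        exact Set.mem_iUnion₂.2 ⟨q, ht.mem_toFinset.2 hq, hx.2, hxq⟩
      _ ≤ ∑ x ∈ ht.toFinset, volume (Eᶜ ∩ ball x r) := measure_biUnion_finset_le _ _
      _ ≤ N * (κ / (N + 1)) := by
        refine (Finset.sum_le_card_nsmul _ _ _ fun x hx =>
          (hcon x (ht.mem_toFinset.1 hx)).le).trans_eq (nsmul_eq_mul _ _)
    have h2 : N * (κ / (N + 1)) < N * (κ / (N + 1)) + κ / (N + 1) :=
      ENNReal.lt_add_right (ENNReal.mul_ne_top (ENNReal.natCast_ne_top N) hδfin) hδ0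
    have h3 : N * (κ / (N + 1)) + κ / (N + 1) = κ := by
      rw [← add_one_mul, ENNReal.mul_div_cancel hN0 hNfin]
    exact (h1.trans_lt h2).ne h3.symm
  obtain ⟨s, hs, hsvol⟩ := exists_volume_inter_ball_eq hn1 Eᶜ p hr0.le
    ((tsub_le_iff_left.2 hBA).trans hp : B - A ≤ _)
  have hsub : E ∪ ball p s ⊆ closure G := Set.union_subset hEG
    (((ball_subset_ball (hs.2.trans hrρ)).trans
      ((ball_subset_thickening (htK hpt) ρ).trans hρ)).trans subset_closure)
  have hvol : volume (E ∪ ball p s) = B := by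
    rw [← Set.union_sdiff_self, measure_union Set.disjoint_sdiff_right
      (measurableSet_ball.diff hE), Set.sdiff_eq, Set.inter_comm, hsvol, hEA,
      add_tsub_cancel_of_le hAB]
  have hper : per (E ∪ ball p s) ≤ per E + ε := by
    rcases hs.1.eq_or_lt with h0 | h0
    · rw [← h0, ball_zero, Set.union_empty]
      exact le_self_add
    · refine (hC E p s hE h0).trans (add_le_add_right ((ENNReal.ofReal_le_ofReal ?_).trans hrε) _)
      exact mul_le_mul_of_nonneg_left (pow_le_pow_left₀ hs.1 hs.2 _) hC0
  rw [← hvol]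
  exact (isoProfile_le (hE.union measurableSet_ball) hsub).trans hper

lemma continuousOn_isoProfile (hn : 2 ≤ n) {G : Set (EuclideanSpace ℝ (Fin n))} (hGo : IsOpen G)
    (hG : Bornology.IsBounded G) {A₀ : ℝ≥0∞} (hA₀ : A₀ < volume G) :
    ContinuousOn (isoProfile G) (Set.Icc 0 A₀) := by
  intro x hx
  have hxV : x < volume G := hx.2.trans_lt hA₀
  rw [ContinuousWithinAt, ENNReal.tendsto_nhds (isoProfile_lt_top hn hGo hG hxV).ne]
  intro ε hε
  obtain ⟨δ, hδ0, hδ⟩ := exists_isoProfile_le_add hn hGo hA₀ hε.ne'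
  filter_upwards [self_mem_nhdsWithin,
    mem_nhdsWithin_of_mem_nhds (ENNReal.Icc_mem_nhds hxV.ne_top hδ0)] with y hy hxy
  have hmono := isoProfile_mono hn hG
  rw [Set.mem_Icc, tsub_le_iff_right]
  rcases le_total x y with h | h
  · exact ⟨(hmono h).trans le_self_add, hδ x y h hy.2 hxy.2⟩
  · exact ⟨hδ y x h hx.2 (tsub_le_iff_right.1 hxy.1), (hmono h).trans le_self_add⟩

end Profile

/-- On a bounded subregion the isoperimetric profile maps `[0, volume G)` bijectively onto
`[0, per G)`; in particular `isoProfile G A` tends to `per G` as `A` tends to `volume G`. -/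
theorem isoProfile_bijOn (n : ℕ) (hn : 2 ≤ n)
    (G : Set (EuclideanSpace ℝ (Fin n))) (hGopen : IsOpen G)
    (hGnull : volume (frontier G) = 0) (hGbdd : Bornology.IsBounded G) :
    Set.BijOn (isoProfile G) (Set.Iio (volume G)) (Set.Iio (per G)) ∧
      Filter.Tendsto (isoProfile G) (nhdsWithin (volume G) (Set.Iio (volume G)))
        (nhds (per G)) := by
  have hlt (A : ℝ≥0∞) (hA : A < volume G) : isoProfile G A < per G :=
    (isoProfile_lt_isoProfile hn hGopen hGbdd hA hA).trans_le
      (isoProfile_le hGopen.measurableSet subset_closure)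
  refine ⟨⟨fun A hA => hlt A hA, ?_, fun P hP => ?_⟩,
    tendsto_order.2 ⟨fun P hP => ?_, fun P hP => ?_⟩⟩
  · refine StrictMonoOn.injOn fun A hA B _ hAB => ?_
    exact isoProfile_lt_isoProfile hn hGopen hGbdd hA hAB
  · obtain ⟨A₀, hA₀, h⟩ := exists_forall_lt_isoProfile hGopen hGnull hGbdd hP
    obtain ⟨A, hA, hAP⟩ := intermediate_value_Icc (zero_le (a := A₀))
      (continuousOn_isoProfile hn hGopen hGbdd hA₀)
      ⟨(isoProfile_zero G).trans_le (zero_le (a := P)), (h A₀ le_rfl).le⟩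
    exact ⟨A, hA.2.trans_lt hA₀, hAP⟩
  · obtain ⟨A₀, hA₀, h⟩ := exists_forall_lt_isoProfile hGopen hGnull hGbdd hP
    filter_upwards [mem_nhdsWithin_of_mem_nhds (Ioi_mem_nhds hA₀)] with A hA
    exact h A (le_of_lt hA)
  · filter_upwards [self_mem_nhdsWithin] with A hA
    exact (hlt A hA).trans hP
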